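/- arXiv:1506.05546 — 2 statements merged into one kernel-verified Lean document; each statement's English description precedes it below -/
import Mathlib

section
/- For n ≥ 4, the number of fully commutative elements w of the Coxeter group W(Dₙ) of type II — those such that no reduced word for w contains the two-letter word s_{1̄} s₁ as a contiguous subword — equals centralBinom n / 2 = (1/2)·binom(2n, n). -/
noncomputable section

/-- Adjacency in the Coxeter graph of type `Dₙ`: the index set is `Fin n`, where `0`
stands for the generator `s₁̄` and `k` stands for `sₖ` for `1 ≤ k ≤ n − 1`.  The vertex
`s₁̄` is joined to `s₂`, and the vertices `s₁, …, s_{n−1}` form a path. -/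
def DnAdj (n : ℕ) (i j : Fin n) : Prop :=
  ((i : ℕ) = 0 ∧ (j : ℕ) = 2) ∨ ((j : ℕ) = 0 ∧ (i : ℕ) = 2) ∨
    (1 ≤ (i : ℕ) ∧ 1 ≤ (j : ℕ) ∧ ((i : ℕ) + 1 = (j : ℕ) ∨ (j : ℕ) + 1 = (i : ℕ)))

instance (n : ℕ) (i j : Fin n) : Decidable (DnAdj n i j) := by
  unfold DnAdj; infer_instance

theorem DnAdj.symm {n : ℕ} {i j : Fin n} (h : DnAdj n i j) : DnAdj n j i := by
  unfold DnAdj at *; tauto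

/-- The Coxeter matrix of type `Dₙ`, with index set `Fin n`, where `0` stands for the
generator `s₁̄` and `k` stands for `sₖ` for `1 ≤ k ≤ n − 1`. -/
def DnMatrix (n : ℕ) : CoxeterMatrix (Fin n) where
  M := Matrix.of fun i j => if i = j then 1 else if DnAdj n i j then 3 else 2
  isSymm := by
    ext i j
    simp only [Matrix.transpose_apply, Matrix.of_apply]
    by_cases h : i = j
    · subst h; simp
    · rw [if_neg h, if_neg (Ne.symm h)]
      by_cases h2 : DnAdj n i j
      · rw [if_pos h2, if_pos h2.symm]
      · rw [if_neg h2, if_neg (fun hc => h2 hc.symm)]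
  diagonal := fun i => by simp
  off_diagonal := fun i j h => by
    simp only [Matrix.of_apply]
    rw [if_neg h]
    split <;> norm_num

/-- A *commutation move* on words: replace a contiguous subword `[i, j]` by `[j, i]`
whenever `M i j = 2`. -/
def CommutationMoveRel {B : Type*} (M : CoxeterMatrix B) (ω ω' : List B) : Prop :=
  ∃ (i j : B) (l₁ l₂ : List B), M i j = 2 ∧
    ω = l₁ ++ [i, j] ++ l₂ ∧ ω' = l₁ ++ [j, i] ++ l₂

/-- `w` is *fully commutative* if any two reduced words for `w` are related by a sequence
of commutation moves. -/
def IsFullyCommutative {B : Type*} {W : Type*} [Group W] {M : CoxeterMatrix B}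
    (cs : CoxeterSystem M W) (w : W) : Prop :=
  ∀ ω ω' : List B, cs.IsReduced ω → cs.IsReduced ω' →
    cs.wordProd ω = w → cs.wordProd ω' = w →
    Relation.ReflTransGen (CommutationMoveRel M) ω ω'

namespace CoxeterSystem

variable {B W : Type*} [Group W] {M : CoxeterMatrix B} (cs : CoxeterSystem M W)

open Classical in
/-- The permutation of `W × ZMod 2` attached to a simple reflection: conjugate the first
component and flip the sign when it is the reflection itself. -/
def signedConj (i : B) : Equiv.Perm (W × ZMod 2) :=
  Function.Involutive.toPerm
    (fun p => (cs.simple i * p.1 * cs.simple i, p.2 + if p.1 = cs.simple i then 1 else 0)) (by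
      rintro ⟨t, ε⟩
      have h : cs.simple i * t * cs.simple i = cs.simple i ↔ t = cs.simple i := by
        constructor
        · intro h
          have := congrArg (fun x => cs.simple i * x * cs.simple i) h
          simpa [mul_assoc] using this
        · rintro rfl; simp
      ext
      · simp [mul_assoc]
      · by_cases ht : t = cs.simple i
        · simp [ht, add_assoc, CharTwo.add_self_eq_zero]
        · simp [h, ht])

open Classical in
theorem signedConj_apply (i : B) (t : W) (ε : ZMod 2) :
    cs.signedConj i (t, ε) =
      (cs.simple i * t * cs.simple i, ε + if t = cs.simple i then 1 else 0) := rfl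

open Classical in
theorem prod_map_signedConj (ω : List B) (t : W) (ε : ZMod 2) :
    (ω.map cs.signedConj).prod (t, ε) =
      (cs.wordProd ω * t * (cs.wordProd ω)⁻¹, ε + ((cs.rightInvSeq ω).count t : ZMod 2)) := by
  induction ω with
  | nil => simp
  | cons i ω ih =>
    rw [List.map_cons, List.prod_cons, Equiv.Perm.mul_apply, ih]
    have h : cs.wordProd ω * t * (cs.wordProd ω)⁻¹ = cs.simple i ↔
        (cs.wordProd ω)⁻¹ * cs.simple i * cs.wordProd ω = t := by
      constructor
      · intro h; rw [← h]; group
      · intro h; rw [← h]; group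
    simp only [mul_assoc] at h
    simp [signedConj_apply, wordProd_cons, mul_assoc, rightInvSeq, List.count_cons, h, add_assoc]

theorem prod_map_alternatingWord {G : Type*} [Monoid G] (f : B → G) (i j : B) (m : ℕ) :
    ((alternatingWord i j (2 * m)).map f).prod = (f i * f j) ^ m := by
  induction m with
  | zero => simp [alternatingWord]
  | succ m ih =>
    rw [show 2 * (m + 1) = 2 * m + 1 + 1 by ring, alternatingWord_succ', alternatingWord_succ',
      pow_succ', ← ih]
    simp [mul_assoc]

theorem leftInvSeq_braid_append (i j : B) :
    ∃ L : List W, cs.leftInvSeq (alternatingWord i j (2 * M i j)) = L ++ L := by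
  refine ⟨(cs.leftInvSeq (alternatingWord i j (2 * M i j))).take (M i j), ?_⟩
  apply List.ext_getElem
  · simp; omega
  · intro k h₁ h₂
    have hk : k < 2 * M i j := by simpa using h₁
    rw [List.getElem_append]
    split_ifs with h
    · simp
    · have hk' : M i j ≤ k := by simp at h; omega
      have hl : (List.take (M i j) (cs.leftInvSeq (alternatingWord i j (2 * M i j)))).length
          = M i j := by simp; omega
      simp only [hl, List.getElem_take]
      rw [getElem_leftInvSeq_alternatingWord _ _ _ _ _ hk,
        getElem_leftInvSeq_alternatingWord _ _ _ _ _ (by omega),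
        prod_alternatingWord_eq_mul_pow, prod_alternatingWord_eq_mul_pow]
      have e1 : (2 * k + 1) / 2 = (k - M i j) + M i j := by omega
      have e2 : (2 * (k - M i j) + 1) / 2 = k - M i j := by omega
      have e3 : (cs.simple j * cs.simple i) ^ M i j = 1 := by
        rw [M.symmetric i j]; exact cs.simple_mul_simple_pow j i
      rw [e1, e2, pow_add, e3]
      simp

theorem isLiftable_signedConj : M.IsLiftable cs.signedConj := by
  classical
  intro i j
  rw [← prod_map_alternatingWord]
  ext1 ⟨t, ε⟩
  rw [prod_map_signedConj]
  have h1 : cs.wordProd (alternatingWord i j (2 * M i j)) = 1 := by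
    rw [wordProd, prod_map_alternatingWord, cs.simple_mul_simple_pow]
  have h2 : ((cs.rightInvSeq (alternatingWord i j (2 * M i j))).count t : ZMod 2) = 0 := by
    obtain ⟨L, hL⟩ := cs.leftInvSeq_braid_append j i
    rw [M.symmetric j i] at hL
    have hrev : ∀ m, alternatingWord i j (2 * m) = (alternatingWord j i (2 * m)).reverse := by
      intro m
      induction m with
      | zero => simp [alternatingWord]
      | succ m ih =>
        rw [show 2 * (m + 1) = 2 * m + 1 + 1 by ring, alternatingWord_succ', alternatingWord_succ',
          alternatingWord_succ, alternatingWord_succ, ih]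
        simp
    rw [hrev, rightInvSeq_reverse, List.count_reverse, hL, List.count_append, Nat.cast_add,
      CharTwo.add_self_eq_zero]
  simp [h1, h2]

open Classical in
theorem count_rightInvSeq_congr {ω ω' : List B} (h : cs.wordProd ω = cs.wordProd ω') (t : W) :
    ((cs.rightInvSeq ω).count t : ZMod 2) = ((cs.rightInvSeq ω').count t : ZMod 2) := by
  have key : ∀ ω : List B, cs.lift ⟨cs.signedConj, cs.isLiftable_signedConj⟩ (cs.wordProd ω) =
      (ω.map cs.signedConj).prod := by
    intro ω
    rw [wordProd, map_list_prod, List.map_map]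
    congr 1
    exact List.map_congr_left fun i _ => cs.lift_apply_simple cs.isLiftable_signedConj i
  have h1 := congrArg (fun g : Equiv.Perm (W × ZMod 2) => (g (t, 0)).2)
    ((key ω).symm.trans ((congrArg _ h).trans (key ω')))
  simpa [prod_map_signedConj] using h1

open Classical in
theorem count_leftInvSeq_congr {ω ω' : List B} (h : cs.wordProd ω = cs.wordProd ω') (t : W) :
    ((cs.leftInvSeq ω).count t : ZMod 2) = ((cs.leftInvSeq ω').count t : ZMod 2) := by
  have := cs.count_rightInvSeq_congr (ω := ω.reverse) (ω' := ω'.reverse) (by simp [h]) t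
  simpa [rightInvSeq_reverse] using this

/-- The exchange property for left descents. -/
theorem exists_eraseIdx_of_isLeftDescent {ω : List B} {i : B}
    (h : cs.IsLeftDescent (cs.wordProd ω) i) :
    ∃ k < ω.length, cs.simple i * cs.wordProd ω = cs.wordProd (ω.eraseIdx k) := by
  classical
  obtain ⟨v, hv, hvw⟩ := cs.exists_isReduced (cs.simple i * cs.wordProd ω)
  have hprod : cs.wordProd ω = cs.wordProd (i :: v) := by
    rw [wordProd_cons, ← hvw, simple_mul_simple_cancel_left]
  have hred : cs.IsReduced (i :: v) := by
    rw [IsReduced, ← hprod, List.length_cons, ← hv.eq, ← hvw]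
    exact (cs.isLeftDescent_iff.mp h).symm
  have hmem : cs.simple i ∈ cs.leftInvSeq (i :: v) := by simp [leftInvSeq]
  have hcount := cs.count_leftInvSeq_congr hprod (cs.simple i)
  rw [List.count_eq_one_of_mem hred.nodup_leftInvSeq hmem] at hcount
  have hmem' : cs.simple i ∈ cs.leftInvSeq ω := by
    by_contra hn
    rw [List.count_eq_zero_of_not_mem hn] at hcount
    simp at hcount
  obtain ⟨k, hk, hk'⟩ := List.mem_iff_getElem.mp hmem'
  refine ⟨k, by simpa using hk, ?_⟩
  rw [← getD_leftInvSeq_mul_wordProd, List.getD_eq_getElem _ _ hk, hk']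

end CoxeterSystem

namespace CoxeterMatrix

/-- A Coxeter matrix is simply laced if all its off-diagonal entries are `2` or `3`. -/
def IsSimplyLaced {B : Type*} (M : CoxeterMatrix B) : Prop :=
  ∀ i j, i ≠ j → M i j = 2 ∨ M i j = 3

open Classical in
/-- The firing move at `i` of the numbers game of a simply laced Coxeter graph. -/
def fire {B : Type*} (M : CoxeterMatrix B) (i : B) : Function.End (B → ℤ) :=
  fun x k => if k = i then -x i else if M i k = 3 then x k + x i else x k

theorem IsSimplyLaced.isLiftable_fire {B : Type*} {M : CoxeterMatrix B} (hM : M.IsSimplyLaced) :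
    M.IsLiftable M.fire := by
  have hmul : ∀ (f g : Function.End (B → ℤ)) (x : B → ℤ), (f * g) x = f (g x) := fun _ _ _ => rfl
  have hone : ∀ x : B → ℤ, (1 : Function.End (B → ℤ)) x = x := fun _ => rfl
  intro i j
  by_cases hij : i = j
  · subst hij
    funext x k
    simp only [M.diagonal, pow_one, hmul, hone]
    grind [fire]
  · have hs : M j i = M i j := M.symmetric j i
    have hi := M.diagonal i
    have hj := M.diagonal j
    rcases hM i j hij with h | h <;>
    · funext x k
      simp only [h, pow_succ, pow_zero, one_mul, hmul, hone]
      grind [fire]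

end CoxeterMatrix

namespace CoxeterSystem

variable {B W : Type*} [Group W] {M : CoxeterMatrix B} (cs : CoxeterSystem M W)

theorem simple_injective_of_isSimplyLaced (hM : M.IsSimplyLaced) :
    Function.Injective cs.simple := by
  classical
  intro i j h
  by_contra hij
  have hf : M.fire i = M.fire j := by
    rw [← cs.lift_apply_simple hM.isLiftable_fire i, h, cs.lift_apply_simple]
  have := congrFun (congrFun hf (Pi.single i 1)) i
  simp [CoxeterMatrix.fire, hij, Ne.symm hij] at this

/-- If two reduced words of the same element start with different letters `i`, `j`, then the
element has reduced words starting with either of the two braid words in `i` and `j`. -/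
theorem IsReduced.exists_of_cons_cons {cs : CoxeterSystem M W} (hM : M.IsSimplyLaced) {i j : B}
    (hij : i ≠ j) {v v' : List B} (hv : cs.IsReduced (i :: v)) (hv' : cs.IsReduced (j :: v'))
    (h : cs.wordProd (i :: v) = cs.wordProd (j :: v')) :
    (M i j = 2 ∧ ∃ u : List B, u.length + 1 = v.length ∧
      cs.wordProd v = cs.wordProd (j :: u) ∧ cs.wordProd v' = cs.wordProd (i :: u)) ∨
    ∃ u : List B, u.length + 2 = v.length ∧ cs.wordProd v = cs.wordProd (j :: i :: u) := by
  have hne : cs.simple i ≠ cs.simple j := fun h => hij (cs.simple_injective_of_isSimplyLaced hM h)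
  have hlen : cs.length (cs.wordProd (i :: v)) = v.length + 1 := hv
  have hlen' : v'.length = v.length := by
    have : cs.length (cs.wordProd (j :: v')) = v'.length + 1 := hv'
    rw [← h, hlen] at this; omega
  have hjw : cs.simple j * cs.wordProd (i :: v) = cs.wordProd v' := by
    rw [h, wordProd_cons, simple_mul_simple_cancel_left]
  have hdj : cs.IsLeftDescent (cs.wordProd (i :: v)) j := by
    rw [IsLeftDescent, hjw, hlen]
    have := cs.length_wordProd_le v'
    omega
  obtain ⟨k, hk, hk'⟩ := cs.exists_eraseIdx_of_isLeftDescent hdj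
  rcases k with _ | k
  · exfalso
    rw [List.eraseIdx_cons_zero, wordProd_cons, ← mul_assoc] at hk'
    have := mul_eq_right.mp hk'
    apply hne
    rw [← cs.inv_simple j]
    exact (eq_inv_of_mul_eq_one_right this)
  rw [List.eraseIdx_cons_succ] at hk'
  have hk2 : k < v.length := by simpa using hk
  have hv1 : (v.eraseIdx k).length + 1 = v.length := List.length_eraseIdx_add_one hk2
  generalize v.eraseIdx k = v₁ at hk' hv1
  have hw : cs.wordProd (i :: v) = cs.wordProd (j :: i :: v₁) := by
    rw [wordProd_cons cs j, ← hk', simple_mul_simple_cancel_left]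
  have hiw : cs.simple i * cs.wordProd (j :: i :: v₁) = cs.wordProd v := by
    rw [← hw, wordProd_cons, simple_mul_simple_cancel_left]
  have hdi : cs.IsLeftDescent (cs.wordProd (j :: i :: v₁)) i := by
    rw [IsLeftDescent, hiw, ← hw, hlen]
    have := cs.length_wordProd_le v
    omega
  obtain ⟨k, hk, hk₁⟩ := cs.exists_eraseIdx_of_isLeftDescent hdi
  rw [hiw] at hk₁
  rcases k with _ | _ | k
  · exfalso
    rw [List.eraseIdx_cons_zero] at hk₁
    rw [wordProd_cons, hk₁, wordProd_cons, simple_mul_simple_cancel_left] at hlen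
    have := cs.length_wordProd_le v₁
    omega
  · left
    simp only [List.eraseIdx_cons_succ, List.eraseIdx_cons_zero] at hk₁
    refine ⟨?_, v₁, hv1, hk₁, by rw [← hjw, hk']⟩
    rcases hM i j hij with h2 | h3
    · exact h2
    · exfalso
      rw [wordProd_cons, hk₁] at hw
      simp only [wordProd_cons, ← mul_assoc, mul_left_inj] at hw
      have hp := cs.simple_mul_simple_pow i j
      rw [h3, pow_succ, pow_two] at hp
      nth_rw 2 [hw] at hp
      apply hne
      have h1 : cs.simple i * cs.simple j = 1 := by
        simpa [mul_assoc] using hp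
      rw [← cs.inv_simple j]
      exact eq_inv_of_mul_eq_one_left h1
  · right
    simp only [List.eraseIdx_cons_succ] at hk₁
    have hk2 : k < v₁.length := by simpa using hk
    have hv2 := List.length_eraseIdx_add_one hk2
    exact ⟨v₁.eraseIdx k, by omega, hk₁⟩

end CoxeterSystem

section CommutationClasses

variable {B : Type*} {M : CoxeterMatrix B}

open Relation

theorem CommutationMoveRel.symm {ω ω' : List B} (h : CommutationMoveRel M ω ω') :
    CommutationMoveRel M ω' ω := by
  obtain ⟨i, j, l₁, l₂, hij, rfl, rfl⟩ := h
  exact ⟨j, i, l₁, l₂, by rw [M.symmetric, hij], rfl, rfl⟩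

theorem CommutationMoveRel.append_left {ω ω' : List B} (l : List B)
    (h : CommutationMoveRel M ω ω') : CommutationMoveRel M (l ++ ω) (l ++ ω') := by
  obtain ⟨i, j, l₁, l₂, hij, rfl, rfl⟩ := h
  exact ⟨i, j, l ++ l₁, l₂, hij, by simp, by simp⟩

variable (M) in
/-- Two words are commutation equivalent if they are related by commutation moves. -/
abbrev CommEquiv (ω ω' : List B) : Prop := ReflTransGen (CommutationMoveRel M) ω ω'

namespace CommEquiv

theorem symm {ω ω' : List B} (h : CommEquiv M ω ω') : CommEquiv M ω' ω :=
  have : Std.Symm (CommutationMoveRel M) := ⟨fun _ _ => CommutationMoveRel.symm⟩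
  ReflTransGen.stdSymm.symm _ _ h

theorem perm {ω ω' : List B} (h : CommEquiv M ω ω') : ω.Perm ω' := by
  induction h with
  | refl => exact List.Perm.refl _
  | tail _ h ih =>
    obtain ⟨i, j, l₁, l₂, -, rfl, rfl⟩ := h
    exact ih.trans (((List.Perm.swap j i []).append_left l₁).append_right l₂)

theorem append_left {ω ω' : List B} (l : List B) (h : CommEquiv M ω ω') :
    CommEquiv M (l ++ ω) (l ++ ω') :=
  ReflTransGen.lift (l ++ ·) (fun _ _ => CommutationMoveRel.append_left l) _ _ h

theorem cons {ω ω' : List B} (a : B) (h : CommEquiv M ω ω') :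
    CommEquiv M (a :: ω) (a :: ω') := h.append_left [a]

theorem swap {a b : B} (h : M a b = 2) (y : List B) : CommEquiv M (a :: b :: y) (b :: a :: y) :=
  ReflTransGen.single ⟨a, b, [], y, h, rfl, rfl⟩

theorem move_to_front {a : B} {x : List B} (h : ∀ b ∈ x, M a b = 2) (y : List B) :
    CommEquiv M (x ++ a :: y) (a :: (x ++ y)) := by
  induction x with
  | nil => exact ReflTransGen.refl
  | cons b x ih =>
    refine ((ih fun c hc => h c (by simp [hc])).cons b).trans ?_
    exact (swap (h b (by simp)) _).symm

/-- A word is determined up to commutation by its restrictions to a family of subalphabets,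
provided that any two letters that do not commute lie in a common subalphabet. -/
theorem of_filter_eq {ι : Type*} {P : ι → B → Bool}
    (hP : ∀ a b, M a b ≠ 2 → ∃ i, P i a ∧ P i b) {ω ω' : List B}
    (h : ∀ i, ω.filter (P i) = ω'.filter (P i)) : CommEquiv M ω ω' := by
  induction ω generalizing ω' with
  | nil =>
    rcases ω' with _ | ⟨b, y⟩
    · exact ReflTransGen.refl
    · obtain ⟨i, hi, -⟩ := hP b b (by simp)
      have := h i
      simp [hi] at this
  | cons a v ih =>
    have hmem : a ∈ ω' := by
      obtain ⟨i, hi, -⟩ := hP a a (by simp)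
      have : a ∈ ω'.filter (P i) := by rw [← h i]; simp [hi]
      exact (List.mem_filter.mp this).1
    obtain ⟨x, y, rfl, hax⟩ := List.eq_append_cons_of_mem hmem
    have hx : ∀ i, P i a → x.filter (P i) = [] := by
      intro i hi
      have hi' := h i
      rw [List.filter_cons_of_pos hi, List.filter_append] at hi'
      rcases hf : x.filter (P i) with _ | ⟨c, z⟩
      · rfl
      · rw [hf, List.cons_append] at hi'
        have hc : c ∈ x.filter (P i) := by rw [hf]; simp
        rw [← (List.cons.inj hi').1] at hc
        exact absurd (List.mem_filter.mp hc).1 hax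
    have hcomm : ∀ b ∈ x, M a b = 2 := by
      intro b hb
      by_contra hab
      obtain ⟨i, hi, hib⟩ := hP a b hab
      have : b ∈ x.filter (P i) := List.mem_filter.mpr ⟨hb, hib⟩
      simp [hx i hi] at this
    refine CommEquiv.symm ((move_to_front hcomm y).trans (CommEquiv.cons a (CommEquiv.symm ?_)))
    apply ih
    intro i
    have hi' := h i
    by_cases hi : P i a
    · rw [List.filter_cons_of_pos hi, List.filter_append, hx i hi,
        List.filter_cons_of_pos hi] at hi'
      rw [List.filter_append, hx i hi]
      exact (List.cons.inj hi').2
    · simpa [hi] using hi'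

variable {W : Type*} [Group W] (cs : CoxeterSystem M W)

theorem wordProd_eq {ω ω' : List B} (h : CommEquiv M ω ω') :
    cs.wordProd ω = cs.wordProd ω' := by
  induction h with
  | refl => rfl
  | tail _ h ih =>
    obtain ⟨i, j, l₁, l₂, hij, rfl, rfl⟩ := h
    have hp := cs.wordProd_braidWord_eq i j
    rw [CoxeterSystem.braidWord, CoxeterSystem.braidWord, M.symmetric j i, hij] at hp
    simp only [CoxeterSystem.alternatingWord, List.concat_eq_append, List.nil_append,
      List.cons_append] at hp
    rw [ih, CoxeterSystem.wordProd_append, CoxeterSystem.wordProd_append,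
      CoxeterSystem.wordProd_append, CoxeterSystem.wordProd_append, hp]

theorem isReduced {ω ω' : List B} (h : CommEquiv M ω ω') (hω : cs.IsReduced ω) :
    cs.IsReduced ω' := by
  rw [CoxeterSystem.IsReduced, ← h.wordProd_eq cs, hω.eq, h.perm.length_eq]

end CommEquiv

/-- A class of words closed under commutation moves and tails, none of whose members starts with
a square or with a long braid, consists of reduced words of fully commutative elements. -/
theorem isReduced_and_commEquiv_of_class {W : Type*} [Group W] {cs : CoxeterSystem M W}
    (hM : M.IsSimplyLaced) {P : List B → Prop}
    (hcomm : ∀ {ω ω'}, CommEquiv M ω ω' → P ω → P ω') (htail : ∀ {a v}, P (a :: v) → P v)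
    (hsq : ∀ {a v}, ¬ P (a :: a :: v))
    (hbraid : ∀ {a b v}, a ≠ b → P (a :: b :: a :: v) → M a b = 2)
    {ω : List B} (hω : P ω) :
    cs.IsReduced ω ∧
      ∀ ω', cs.IsReduced ω' → cs.wordProd ω = cs.wordProd ω' → CommEquiv M ω ω' := by
  obtain ⟨N, hN⟩ : ∃ N, ω.length = N := ⟨_, rfl⟩
  induction N generalizing ω with
  | zero =>
    obtain rfl := List.length_eq_zero_iff.mp hN
    refine ⟨by simp [CoxeterSystem.IsReduced], fun ω' hω' h => ?_⟩
    have h0 := hω'.eq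
    rw [← h, CoxeterSystem.wordProd_nil, CoxeterSystem.length_one] at h0
    rw [List.length_eq_zero_iff.mp h0.symm]
  | succ N ih =>
    rcases ω with _ | ⟨s, v⟩
    · simp at hN
    have hvN : v.length = N := by simpa using hN
    obtain ⟨hv, hvFC⟩ := ih (htail hω) hvN
    have hred : cs.IsReduced (s :: v) := by
      rcases cs.length_simple_mul (cs.wordProd v) s with h | h
      · rw [CoxeterSystem.IsReduced, CoxeterSystem.wordProd_cons, h, hv.eq, List.length_cons]
      · exfalso
        obtain ⟨x, hx, hxv⟩ := cs.exists_isReduced (cs.simple s * cs.wordProd v)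
        have hprod : cs.wordProd v = cs.wordProd (s :: x) := by
          rw [CoxeterSystem.wordProd_cons, ← hxv, CoxeterSystem.simple_mul_simple_cancel_left]
        have hsx : cs.IsReduced (s :: x) := by
          rw [CoxeterSystem.IsReduced, ← hprod, List.length_cons, ← hx.eq, ← hxv, h]
        exact hsq (hcomm ((hvFC _ hsx hprod).cons s) hω)
    refine ⟨hred, fun ω' hω' h => ?_⟩
    have hlen : ω'.length = N + 1 := by rw [← hω'.eq, ← h, hred.eq, hN]
    rcases ω' with _ | ⟨t, v'⟩
    · simp at hlen
    by_cases hst : s = t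
    · subst hst
      rw [CoxeterSystem.wordProd_cons, CoxeterSystem.wordProd_cons, mul_right_inj] at h
      exact (hvFC v' (hω'.drop 1) h).cons s
    rcases CoxeterSystem.IsReduced.exists_of_cons_cons hM hst hred hω' h with
      ⟨h2, u, hu, hvu, hvu'⟩ | ⟨u, hu, hvu⟩
    · have htu : cs.IsReduced (t :: u) := by
        rw [CoxeterSystem.IsReduced, ← hvu, hv.eq, List.length_cons, hu]
      have hω₂ : CommEquiv M (s :: v) (t :: s :: u) :=
        ((hvFC _ htu hvu).cons s).trans (CommEquiv.swap h2 u)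
      have hlen' : v'.length = N := by simpa using hlen
      exact hω₂.trans (((ih (htail (hcomm hω₂ hω)) (by simp; omega)).2 v' (hω'.drop 1)
        hvu'.symm).cons t)
    · exfalso
      have htsu : cs.IsReduced (t :: s :: u) := by
        rw [CoxeterSystem.IsReduced, ← hvu, hv.eq, List.length_cons, List.length_cons, hu]
      have hω₂ := (hvFC _ htsu hvu).cons s
      have h2 := hbraid hst (hcomm hω₂ hω)
      exact hsq (hcomm ((CommEquiv.swap (by rw [M.symmetric, h2]) u).cons s) (hcomm hω₂ hω))

end CommutationClasses

section LevelWords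

/-- The word of length `k` alternating between `a` and `b`, starting with `a`. -/
def altWord {α : Type*} (a b : α) : ℕ → List α
  | 0 => []
  | k + 1 => a :: altWord b a k

namespace altWord

variable {α : Type*} (a b : α)

@[simp]
theorem length_eq (k : ℕ) : (altWord a b k).length = k := by
  induction k generalizing a b <;> simp [altWord, *]

variable {a b}

theorem eq_or_eq_of_mem {k : ℕ} {x : α} (hx : x ∈ altWord a b k) : x = a ∨ x = b := by
  induction k generalizing a b with
  | zero => simp [altWord] at hx
  | succ k ih =>
    rcases List.mem_cons.mp hx with h | h
    · exact Or.inl h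
    · exact (ih h).symm

theorem isChain_ne (hab : a ≠ b) (k : ℕ) : (altWord a b k).IsChain (· ≠ ·) := by
  induction k generalizing a b with
  | zero => simp [altWord]
  | succ k ih =>
    refine List.isChain_cons.mpr ⟨fun x hx => ?_, ih hab.symm⟩
    cases k
    · simp [altWord] at hx
    · simp only [altWord, List.head?_cons, Option.mem_def, Option.some.injEq] at hx
      exact hx ▸ hab

theorem eq_of_isChain_ne {l : List α} (hl : l.IsChain (· ≠ ·)) (h : ∀ x ∈ l, x = a ∨ x = b) :
    l = altWord a b l.length ∨ l = altWord b a l.length := by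
  induction l with
  | nil => simp [altWord]
  | cons x l ih =>
    obtain ⟨hx, hl⟩ := List.isChain_cons.mp hl
    have ih := ih hl fun y hy => h y (by simp [hy])
    rcases l with _ | ⟨y, l⟩
    · simpa [altWord] using h x
    · have hxy : x ≠ y := hx y (by simp)
      simp only [List.length_cons, altWord, List.cons.injEq] at ih ⊢
      have hxab := h x (by simp)
      clear * - hxy hxab ih
      grind

theorem count_left_and_right [DecidableEq α] (hab : a ≠ b) (k : ℕ) :
    (altWord a b k).count a = (k + 1) / 2 ∧ (altWord a b k).count b = k / 2 := by
  induction k generalizing a b with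
  | zero => simp [altWord]
  | succ k ih =>
    obtain ⟨h₁, h₂⟩ := ih hab.symm
    simp only [altWord, List.count_cons, h₁, h₂, beq_self_eq_true, if_true, beq_iff_eq, hab,
      if_false]
    omega

theorem ne_swap (hab : a ≠ b) {k l : ℕ} (hk : k ≠ 0) : altWord a b k ≠ altWord b a l := by
  obtain ⟨k, rfl⟩ := Nat.exists_eq_succ_of_ne_zero hk
  cases l <;> simp [altWord, hab]

end altWord

/-- The predicate selecting the two consecutive levels `e` and `e + 1`. -/
def inPair (e l : ℕ) : Bool := l = e ∨ l = e + 1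

theorem inPair_iff {e l : ℕ} : inPair e l = true ↔ l = e ∨ l = e + 1 := by simp [inPair]

/-- The words alternating between `d` and `d + 1` in which `d` occurs `c` times. -/
def altWords (d c : ℕ) : Finset (List ℕ) :=
  {altWord d (d + 1) (2 * c - 1), altWord d (d + 1) (2 * c), altWord (d + 1) d (2 * c),
    altWord (d + 1) d (2 * c + 1)}

theorem mem_altWords {d c : ℕ} {z : List ℕ} :
    z ∈ altWords d c ↔
      z.IsChain (· ≠ ·) ∧ (∀ l ∈ z, inPair d l) ∧ z.count d = c := by
  have hd : d ≠ d + 1 := by omega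
  have h₁ := altWord.count_left_and_right hd
  have h₂ := altWord.count_left_and_right hd.symm
  constructor
  · intro hz
    simp only [altWords, Finset.mem_insert, Finset.mem_singleton] at hz
    have hm : ∀ k, ∀ l ∈ altWord d (d + 1) k, inPair d l := fun k l hl =>
      inPair_iff.mpr (altWord.eq_or_eq_of_mem hl)
    have hm' : ∀ k, ∀ l ∈ altWord (d + 1) d k, inPair d l := fun k l hl =>
      inPair_iff.mpr (altWord.eq_or_eq_of_mem hl).symm
    rcases hz with rfl | rfl | rfl | rfl
    · exact ⟨altWord.isChain_ne hd _, hm _, by rw [(h₁ _).1]; omega⟩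
    · exact ⟨altWord.isChain_ne hd _, hm _, by rw [(h₁ _).1]; omega⟩
    · exact ⟨altWord.isChain_ne hd.symm _, hm' _, by rw [(h₂ _).2]; omega⟩
    · exact ⟨altWord.isChain_ne hd.symm _, hm' _, by rw [(h₂ _).2]; omega⟩
  · rintro ⟨hz, hl, rfl⟩
    simp only [altWords, Finset.mem_insert, Finset.mem_singleton]
    obtain ⟨k, rfl | rfl⟩ : ∃ k, z = altWord d (d + 1) k ∨ z = altWord (d + 1) d k :=
      ⟨_, altWord.eq_of_isChain_ne hz fun l h => inPair_iff.mp (hl l h)⟩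
    · rw [(h₁ k).1]
      rcases Nat.even_or_odd' k with ⟨m, rfl | rfl⟩
      · right; left; congr 1; omega
      · left; congr 1; omega
    · rw [(h₂ k).2]
      rcases Nat.even_or_odd' k with ⟨m, rfl | rfl⟩
      · right; right; left; congr 1; omega
      · right; right; right; congr 1; omega

theorem sum_altWords {R : Type*} [AddCommMonoid R] (d c : ℕ) (f : ℕ → R) :
    ∑ z ∈ altWords d c, f (z.count (d + 1)) =
      if c = 0 then f 0 + f 1 else f (c - 1) + (f c + (f c + f (c + 1))) := by
  have hd : d ≠ d + 1 := by omega
  have h₁ := fun k => (altWord.count_left_and_right hd k).2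
  have h₂ := fun k => (altWord.count_left_and_right hd.symm k).1
  split_ifs with hc
  · subst hc
    simp [altWords, altWord]
  · have hlen : ∀ {a b k l : ℕ}, k ≠ l → altWord a b k ≠ altWord a b l := fun hkl h =>
      hkl (by simpa using congrArg List.length h)
    have hne : ∀ {k l : ℕ}, k ≠ 0 → altWord d (d + 1) k ≠ altWord (d + 1) d l :=
      fun hk => altWord.ne_swap hd hk
    rw [altWords, Finset.sum_insert, Finset.sum_insert, Finset.sum_pair, h₁, h₁, h₂, h₂]
    · rw [show (2 * c - 1) / 2 = c - 1 by omega, show 2 * c / 2 = c by omega,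
        show (2 * c + 1) / 2 = c by omega, show (2 * c + 1 + 1) / 2 = c + 1 by omega]
    · exact hlen (by omega)
    · simp only [Finset.mem_insert, Finset.mem_singleton, not_or]
      exact ⟨hne (by omega), hne (by omega)⟩
    · simp only [Finset.mem_insert, Finset.mem_singleton, not_or]
      exact ⟨hlen (by omega), hne (by omega), hne (by omega)⟩

theorem exists_merge {d : ℕ} {u z : List ℕ} (hu : ∀ l ∈ u, l ≤ d) (hz : ∀ l ∈ z, inPair d l)
    (h : u.count d = z.count d) :
    ∃ w : List ℕ, w.filter (· ≤ d) = u ∧ w.filter (inPair d) = z ∧ ∀ l ∈ w, l ∈ u ∨ l ∈ z := by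
  induction u generalizing z with
  | nil =>
    have hzd : ∀ l ∈ z, l ≠ d := by
      rintro l hl rfl
      exact absurd (h ▸ List.count_pos_iff.mpr hl) (by simp)
    refine ⟨z, List.filter_eq_nil_iff.mpr fun l hl => ?_, List.filter_eq_self.mpr hz, by simp⟩
    have h₁ := inPair_iff.mp (hz l hl)
    have h₂ := hzd l hl
    simp only [decide_eq_true_eq]
    omega
  | cons a u ih =>
    have hu' : ∀ l ∈ u, l ≤ d := fun l hl => hu l (by simp [hl])
    have had : a ≤ d := hu a (by simp)
    by_cases ha : a = d
    · subst ha
      induction z with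
      | nil => simp at h
      | cons b z ihz =>
        have hz' : ∀ l ∈ z, inPair a l := fun l hl => hz l (by simp [hl])
        have hb := hz b (by simp)
        by_cases hba : b = a
        · subst hba
          obtain ⟨w, h₁, h₂, h₃⟩ := ih hu' hz' (by simpa using h)
          exact ⟨b :: w, by simp [h₁], by simp [h₂, hb], by grind⟩
        · obtain ⟨w, h₁, h₂, h₃⟩ := ihz hz' (by simpa [List.count_cons, hba] using h)
          have : ¬ b ≤ a := by have := inPair_iff.mp hb; omega
          exact ⟨b :: w, by simp [h₁, this], by simp [h₂, hb], by grind⟩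
    · obtain ⟨w, h₁, h₂, h₃⟩ := ih hu' hz (by simpa [List.count_cons, ha] using h)
      have : inPair d a = false := by
        rw [← Bool.not_eq_true, inPair_iff]; omega
      exact ⟨a :: w, by simp [h₁, had], by simp [h₂, this], by grind⟩

/-- A word whose restrictions to the letters `≤ d` and to `{d, d + 1}` are `u` and `z`. -/
def mergeWord (d : ℕ) (u z : List ℕ) : List ℕ :=
  Classical.epsilon fun w =>
    w.filter (· ≤ d) = u ∧ w.filter (inPair d) = z ∧ ∀ l ∈ w, l ∈ u ∨ l ∈ z

theorem mergeWord_spec {d : ℕ} {u z : List ℕ} (hu : ∀ l ∈ u, l ≤ d)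
    (hz : z ∈ altWords d (u.count d)) :
    (mergeWord d u z).filter (· ≤ d) = u ∧ (mergeWord d u z).filter (inPair d) = z ∧
      ∀ l ∈ mergeWord d u z, l ∈ u ∨ l ∈ z :=
  have hz := mem_altWords.mp hz
  Classical.epsilon_spec (exists_merge hu hz.2.1 hz.2.2.symm)

/-- A word in the levels `1, …, d` is a level word if its restriction to any two consecutive
levels alternates; in particular, level `1` occurs at most once. -/
def IsLevelWord (d : ℕ) (v : List ℕ) : Prop :=
  (∀ l ∈ v, 1 ≤ l ∧ l ≤ d) ∧ ∀ e < d, (v.filter (inPair e)).IsChain (· ≠ ·)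

theorem filter_inPair_filter_le {e d : ℕ} (he : e < d) (v : List ℕ) :
    (v.filter (· ≤ d)).filter (inPair e) = v.filter (inPair e) := by
  rw [List.filter_filter]
  refine List.filter_congr fun l _ => ?_
  rw [Bool.eq_iff_iff, Bool.and_eq_true, inPair_iff, decide_eq_true_eq]
  omega

theorem count_filter_inPair (d : ℕ) (v : List ℕ) :
    (v.filter (inPair d)).count d = v.count d ∧
      (v.filter (inPair d)).count (d + 1) = v.count (d + 1) :=
  ⟨List.count_filter (by simp [inPair]), List.count_filter (by simp [inPair])⟩

theorem count_eq_of_filter_inPair_eq {d : ℕ} {u v : List ℕ} (hu : ∀ l ∈ u, 1 ≤ l)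
    (hv : ∀ l ∈ v, 1 ≤ l) (h : ∀ e < d, u.filter (inPair e) = v.filter (inPair e)) :
    u.count d = v.count d := by
  rcases d with _ | d
  · rw [List.count_eq_zero.mpr fun h0 => absurd (hu 0 h0) (by simp),
      List.count_eq_zero.mpr fun h0 => absurd (hv 0 h0) (by simp)]
  · rw [← (count_filter_inPair d u).2, ← (count_filter_inPair d v).2, h d (by simp)]

/-- Representatives, up to equality of the restrictions to pairs of consecutive levels, of the
level words in the levels `1, …, d`. -/
def levelWords : ℕ → Finset (List ℕ)
  | 0 => {[]}
  | d + 1 => ((levelWords d).sigma fun u => altWords d (u.count d)).image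
      fun p => mergeWord d p.1 p.2

theorem mem_levelWords_succ {d : ℕ} {v : List ℕ} :
    v ∈ levelWords (d + 1) ↔
      ∃ u ∈ levelWords d, ∃ z ∈ altWords d (u.count d), mergeWord d u z = v := by
  simp [levelWords, and_assoc]

theorem isLevelWord_of_mem {d : ℕ} {v : List ℕ} (hv : v ∈ levelWords d) : IsLevelWord d v := by
  induction d generalizing v with
  | zero =>
    obtain rfl : v = [] := by simpa [levelWords] using hv
    simp [IsLevelWord]
  | succ d ih =>
    obtain ⟨u, hu, z, hz, rfl⟩ := mem_levelWords_succ.mp hv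
    obtain ⟨hul, hue⟩ := ih hu
    obtain ⟨h₁, h₂, h₃⟩ := mergeWord_spec (fun l hl => (hul l hl).2) hz
    obtain ⟨hzc, hzl, hzd⟩ := mem_altWords.mp hz
    refine ⟨fun l hl => ?_, fun e he => ?_⟩
    · by_cases hlu : l ∈ u
      · have := hul l hlu; omega
      · have hlz := (h₃ l hl).resolve_left hlu
        rcases inPair_iff.mp (hzl l hlz) with rfl | rfl
        · exact absurd (List.count_pos_iff.mp (hzd ▸ List.count_pos_iff.mpr hlz)) hlu
        · omega
    · rcases Nat.lt_succ_iff_lt_or_eq.mp he with he | rfl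
      · rw [← filter_inPair_filter_le he, h₁]
        exact hue e he
      · rwa [h₂]

theorem exists_mem_levelWords {d : ℕ} {v : List ℕ} (hv : IsLevelWord d v) :
    ∃ u ∈ levelWords d, ∀ e < d, u.filter (inPair e) = v.filter (inPair e) := by
  induction d generalizing v with
  | zero => exact ⟨[], by simp [levelWords], by simp⟩
  | succ d ih =>
    have hvd : IsLevelWord d (v.filter (· ≤ d)) := by
      refine ⟨fun l hl => ?_, fun e he => ?_⟩
      · obtain ⟨hl, hld⟩ := List.mem_filter.mp hl
        exact ⟨(hv.1 l hl).1, by simpa using hld⟩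
      · rw [filter_inPair_filter_le he]
        exact hv.2 e (by omega)
    obtain ⟨u, hu, hue⟩ := ih hvd
    have hul := (isLevelWord_of_mem hu).1
    have hz : v.filter (inPair d) ∈ altWords d (u.count d) := by
      refine mem_altWords.mpr ⟨hv.2 d (by omega), fun l hl => (List.mem_filter.mp hl).2, ?_⟩
      rw [(count_filter_inPair d v).1, count_eq_of_filter_inPair_eq (fun l hl => (hul l hl).1)
        (fun l hl => (hvd.1 l hl).1) hue, List.count_filter (by simp)]
    refine ⟨_, mem_levelWords_succ.mpr ⟨u, hu, _, hz, rfl⟩, fun e he => ?_⟩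
    obtain ⟨h₁, h₂, -⟩ := mergeWord_spec (fun l hl => (hul l hl).2) hz
    rcases Nat.lt_succ_iff_lt_or_eq.mp he with he | rfl
    · rw [← filter_inPair_filter_le he, h₁, hue e he, filter_inPair_filter_le he]
    · exact h₂

theorem levelWords_ext {d : ℕ} {u v : List ℕ} (hu : u ∈ levelWords d) (hv : v ∈ levelWords d)
    (h : ∀ e < d, u.filter (inPair e) = v.filter (inPair e)) : u = v := by
  induction d generalizing u v with
  | zero =>
    simp only [levelWords, Finset.mem_singleton] at hu hv
    rw [hu, hv]
  | succ d ih =>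
    obtain ⟨u, hu', z, hz, rfl⟩ := mem_levelWords_succ.mp hu
    obtain ⟨v, hv', y, hy, rfl⟩ := mem_levelWords_succ.mp hv
    obtain ⟨hu₁, hu₂, -⟩ := mergeWord_spec (fun l hl => ((isLevelWord_of_mem hu').1 l hl).2) hz
    obtain ⟨hv₁, hv₂, -⟩ := mergeWord_spec (fun l hl => ((isLevelWord_of_mem hv').1 l hl).2) hy
    obtain rfl : z = y := by rw [← hu₂, ← hv₂, h d (by omega)]
    obtain rfl : u = v := by
      refine ih hu' hv' fun e he => ?_
      rw [← hu₁, ← hv₁, filter_inPair_filter_le he, filter_inPair_filter_le he, h e (by omega)]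
    rfl

theorem sum_levelWords_succ {R : Type*} [AddCommMonoid R] (d : ℕ) (f : ℕ → R) :
    ∑ v ∈ levelWords (d + 1), f (v.count (d + 1)) =
      ∑ u ∈ levelWords d, ∑ z ∈ altWords d (u.count d), f (z.count (d + 1)) := by
  have hspec : ∀ p ∈ (levelWords d).sigma fun u => altWords d (u.count d),
      (mergeWord d p.1 p.2).filter (· ≤ d) = p.1 ∧
        (mergeWord d p.1 p.2).filter (inPair d) = p.2 := fun p hp => by
    obtain ⟨hu, hz⟩ := Finset.mem_sigma.mp hp
    have := mergeWord_spec (fun l hl => ((isLevelWord_of_mem hu).1 l hl).2) hz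
    exact ⟨this.1, this.2.1⟩
  rw [levelWords, Finset.sum_image, Finset.sum_sigma']
  · refine Finset.sum_congr rfl fun p hp => ?_
    rw [← (count_filter_inPair d _).2, (hspec p hp).2]
  · rintro ⟨u, z⟩ hp ⟨v, y⟩ hq hpq
    have hp := hspec _ hp
    have hq := hspec _ hq
    rw [show mergeWord d u z = mergeWord d v y from hpq] at hp
    obtain rfl : u = v := hp.1.symm.trans hq.1
    obtain rfl : z = y := hp.2.symm.trans hq.2
    rfl

theorem sum_levelWords_ite (d c : ℕ) :
    ∑ v ∈ levelWords d, (if c ≤ v.count d then 1 else 0) = (2 * d).choose (d + c) := by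
  induction d generalizing c with
  | zero => cases c <;> simp [levelWords]
  | succ d ih =>
    rw [sum_levelWords_succ d fun k => if c ≤ k then 1 else 0,
      Finset.sum_congr rfl fun u _ => sum_altWords d (u.count d) fun k => if c ≤ k then 1 else 0]
    rcases c with _ | c
    · have : ∀ u : List ℕ, (if u.count d = 0 then 1 + 1 else 1 + (1 + (1 + 1))) =
          2 * (if 0 ≤ u.count d then 1 else 0) + 2 * (if 1 ≤ u.count d then 1 else 0) := by
        intro u; split_ifs <;> omega
      simp only [zero_le, if_true] at this ⊢
      simp only [this, Finset.sum_add_distrib, ← Finset.mul_sum, ih 1]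
      have h0 := ih 0
      simp only [zero_le, if_true] at h0
      rw [h0]
      have h1 := Nat.choose_succ_succ' (2 * d + 1) d
      have h2 := Nat.choose_symm_half d
      have h3 := Nat.choose_succ_succ' (2 * d) d
      rw [show 2 * (d + 1) = 2 * d + 1 + 1 by ring]
      simp only [add_zero]
      omega
    · have : ∀ k : ℕ, (if k = 0 then
            (if c + 1 ≤ 0 then 1 else 0) + (if c + 1 ≤ 1 then 1 else 0) else
            (if c + 1 ≤ k - 1 then 1 else 0) + ((if c + 1 ≤ k then 1 else 0) +
              ((if c + 1 ≤ k then 1 else 0) + if c + 1 ≤ k + 1 then 1 else 0))) =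
          (if c ≤ k then 1 else 0) + 2 * (if c + 1 ≤ k then 1 else 0) +
            if c + 2 ≤ k then 1 else 0 := by
        intro k; split_ifs <;> omega
      simp only [this, Finset.sum_add_distrib, ← Finset.mul_sum, ih]
      have h1 := Nat.choose_succ_succ' (2 * d + 1) (d + c + 1)
      have h2 := Nat.choose_succ_succ' (2 * d) (d + c)
      have h3 := Nat.choose_succ_succ' (2 * d) (d + c + 1)
      rw [show 2 * (d + 1) = 2 * d + 1 + 1 by ring, show d + 1 + (c + 1) = d + c + 1 + 1 by ring]
      rw [show d + (c + 1) = d + c + 1 by ring, show d + (c + 2) = d + c + 1 + 1 by ring]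
      omega

end LevelWords

section Heaps

/-- The distance, shifted by one, from a vertex of the Coxeter graph of type `Dₙ` to the end
`s_{n−1}`; it is `n − 1` for both `s₁̄` and `s₁`. -/
def DnLevel {n : ℕ} (i : Fin n) : ℕ := n - max (i : ℕ) 1

theorem DnMatrix_apply {n : ℕ} (i j : Fin n) :
    DnMatrix n i j = if i = j then 1 else if DnAdj n i j then 3 else 2 := rfl

theorem DnMatrix_isSimplyLaced (n : ℕ) : (DnMatrix n).IsSimplyLaced := by
  intro i j hij
  rw [DnMatrix_apply, if_neg hij]
  split_ifs <;> simp

theorem DnLevel_lt {n : ℕ} (i : Fin n) : DnLevel i < n := by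
  have := i.2
  unfold DnLevel; omega

section Level

variable {n : ℕ}

theorem DnLevel_pos (hn : 4 ≤ n) (i : Fin n) : 0 < DnLevel i := by
  have := i.2
  unfold DnLevel; omega

theorem DnLevel_eq (hn : 4 ≤ n) (i : Fin n) :
    ((i : ℕ) ≤ 1 ∧ DnLevel i = n - 1) ∨ (2 ≤ (i : ℕ) ∧ DnLevel i = n - i) := by
  unfold DnLevel; omega

theorem DnMatrix_eq_three_iff (hn : 4 ≤ n) {i j : Fin n} :
    DnMatrix n i j = 3 ↔ DnLevel i + 1 = DnLevel j ∨ DnLevel j + 1 = DnLevel i := by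
  have hi := i.2
  have hj := j.2
  have hli := DnLevel_eq hn i
  have hlj := DnLevel_eq hn j
  simp only [DnMatrix_apply, Fin.ext_iff]
  split_ifs with h₁ h₂ <;> (try unfold DnAdj at h₂) <;> omega

theorem DnMatrix_eq_two_iff (hn : 4 ≤ n) {i j : Fin n} :
    DnMatrix n i j = 2 ↔ DnLevel i + 1 < DnLevel j ∨ DnLevel j + 1 < DnLevel i ∨
      (i ≠ j ∧ DnLevel i = DnLevel j) := by
  have hi := i.2
  have hj := j.2
  have hli := DnLevel_eq hn i
  have hlj := DnLevel_eq hn j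
  simp only [DnMatrix_apply, ne_eq, Fin.ext_iff]
  split_ifs with h₁ h₂ <;> (try unfold DnAdj at h₂) <;> omega

theorem DnLevel_eq_of_ne (hn : 4 ≤ n) {i j : Fin n} (hij : i ≠ j) (h : DnLevel i = DnLevel j) :
    DnLevel i = n - 1 := by
  have hi := i.2
  have hj := j.2
  rw [ne_eq, Fin.ext_iff] at hij
  unfold DnLevel at *
  omega

end Level

/-- A word is alternating if its restriction to any two consecutive levels alternates between the
two levels, and its restriction to `{s₁̄, s₁}` alternates between these two letters. -/
def IsAlternating {n : ℕ} (ω : List (Fin n)) : Prop :=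
  (∀ e, e + 1 < n → ((ω.map DnLevel).filter (inPair e)).IsChain (· ≠ ·)) ∧
    (ω.filter (DnLevel · = n - 1)).IsChain (· ≠ ·)

namespace IsAlternating

variable {n : ℕ}

theorem of_append {x y : List (Fin n)} (h : IsAlternating (x ++ y)) : IsAlternating y := by
  refine ⟨fun e he => ?_, ?_⟩
  · have := h.1 e he
    rw [List.map_append, List.filter_append] at this
    exact (List.isChain_append.mp this).2.1
  · have := h.2
    rw [List.filter_append] at this
    exact (List.isChain_append.mp this).2.1

theorem of_cons {a : Fin n} {v : List (Fin n)} (h : IsAlternating (a :: v)) : IsAlternating v :=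
  of_append (x := [a]) h

theorem not_cons_cons_of_level_eq (hn : 4 ≤ n) {a b : Fin n} (hab : DnLevel a = DnLevel b)
    {v : List (Fin n)} : ¬ IsAlternating (a :: b :: v) := by
  intro h
  have ha := DnLevel_pos hn a
  have ha' := DnLevel_lt a
  have := h.1 (DnLevel a - 1) (by omega)
  have e : inPair (DnLevel b - 1) (DnLevel b) = true := by simp [inPair]; omega
  simp [hab, e] at this

theorem not_braid (hn : 4 ≤ n) {a b : Fin n} (hab : DnMatrix n a b = 3) {v : List (Fin n)} :
    ¬ IsAlternating (a :: b :: a :: v) := by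
  intro h
  have ha := DnLevel_pos hn a
  have ha' := DnLevel_lt a
  have hb' := DnLevel_lt b
  have hb := DnLevel_pos hn b
  rw [DnMatrix_eq_three_iff hn] at hab
  by_cases hk : DnLevel a = n - 1
  · have := h.2
    have hbn : DnLevel b ≠ n - 1 := by omega
    simp [hk, hbn] at this
  · obtain ⟨e, he, hae, hbe⟩ : ∃ e, e + 1 < n ∧ inPair e (DnLevel a) = true ∧
        inPair e (DnLevel b) = false := by
      rcases hab with hab | hab
      · exact ⟨DnLevel a - 1, by omega, by simp [inPair]; omega, by simp [inPair]; omega⟩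
      · exact ⟨DnLevel a, by omega, by simp [inPair], by simp [inPair]; omega⟩
    have := h.1 e he
    simp [hae, hbe] at this

theorem filter_eq_of_commutationMoveRel (hn : 4 ≤ n) {ω ω' : List (Fin n)}
    (h : CommutationMoveRel (DnMatrix n) ω ω') (hω : IsAlternating ω) :
    (∀ e, (ω'.map DnLevel).filter (inPair e) = (ω.map DnLevel).filter (inPair e)) ∧
      ω'.filter (DnLevel · = n - 1) = ω.filter (DnLevel · = n - 1) := by
  obtain ⟨i, j, l₁, l₂, hij, rfl, rfl⟩ := h
  rw [List.append_assoc] at hω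
  rw [DnMatrix_eq_two_iff hn] at hij
  have hij' : DnLevel i + 1 < DnLevel j ∨ DnLevel j + 1 < DnLevel i := by
    rcases hij with h | h | h
    · exact Or.inl h
    · exact Or.inr h
    · exact absurd hω.of_append (not_cons_cons_of_level_eq hn h.2)
  refine ⟨fun e => ?_, ?_⟩
  · have hp : inPair e (DnLevel i) = false ∨ inPair e (DnLevel j) = false := by
      simp only [inPair, decide_eq_false_iff_not]; omega
    rcases hp with hp | hp <;> simp [List.filter_cons, hp]
  · have hp : DnLevel i ≠ n - 1 ∨ DnLevel j ≠ n - 1 := by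
      omega
    rcases hp with hp | hp <;> simp [List.filter_cons, hp]

theorem filter_eq_of_commEquiv (hn : 4 ≤ n) {ω ω' : List (Fin n)} (h : CommEquiv (DnMatrix n) ω ω')
    (hω : IsAlternating ω) :
    (∀ e, (ω'.map DnLevel).filter (inPair e) = (ω.map DnLevel).filter (inPair e)) ∧
      ω'.filter (DnLevel · = n - 1) = ω.filter (DnLevel · = n - 1) := by
  induction h with
  | refl => simp
  | tail _ h ih =>
    have hω' : IsAlternating _ := ⟨fun e he => ih.1 e ▸ hω.1 e he, ih.2 ▸ hω.2⟩
    obtain ⟨h₁, h₂⟩ := filter_eq_of_commutationMoveRel hn h hω'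
    exact ⟨fun e => (h₁ e).trans (ih.1 e), h₂.trans ih.2⟩

theorem of_commEquiv (hn : 4 ≤ n) {ω ω' : List (Fin n)} (h : CommEquiv (DnMatrix n) ω ω')
    (hω : IsAlternating ω) : IsAlternating ω' := by
  obtain ⟨h₁, h₂⟩ := filter_eq_of_commEquiv hn h hω
  exact ⟨fun e he => h₁ e ▸ hω.1 e he, h₂ ▸ hω.2⟩

/-- Alternating words are the reduced words of fully commutative elements. -/
theorem isReduced_and_commEquiv (hn : 4 ≤ n) {ω : List (Fin n)} (hω : IsAlternating ω) :
    (DnMatrix n).toCoxeterSystem.IsReduced ω ∧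
      ∀ ω', (DnMatrix n).toCoxeterSystem.IsReduced ω' →
        (DnMatrix n).toCoxeterSystem.wordProd ω = (DnMatrix n).toCoxeterSystem.wordProd ω' →
        CommEquiv (DnMatrix n) ω ω' := by
  refine isReduced_and_commEquiv_of_class (DnMatrix_isSimplyLaced n)
    (of_commEquiv hn) of_cons (not_cons_cons_of_level_eq hn rfl) ?_ hω
  intro a b v hab h
  rcases DnMatrix_isSimplyLaced n a b hab with h2 | h3
  · exact h2
  · exact absurd h (not_braid hn h3)

end IsAlternating

theorem length_le_one_of_isChain_ne {α : Type*} {l : List α} (hl : l.IsChain (· ≠ ·)) {k : α}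
    (h : ∀ a ∈ l, a = k) : l.length ≤ 1 := by
  rcases l with _ | ⟨a, _ | ⟨b, l⟩⟩
  · simp
  · simp
  · simp only [List.mem_cons, forall_eq_or_imp] at h
    simp [h.1, h.2.1] at hl

/-- No word in the commutation class of `ω` has two consecutive letters of the same level or a
long braid as a contiguous subword. -/
def AvoidsBraids {n : ℕ} (ω : List (Fin n)) : Prop :=
  ∀ x y : List (Fin n),
    (∀ a b, DnLevel a = DnLevel b → ¬ CommEquiv (DnMatrix n) ω (x ++ a :: b :: y)) ∧
    ∀ a b, DnMatrix n a b = 3 → ¬ CommEquiv (DnMatrix n) ω (x ++ a :: b :: a :: y)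

namespace AvoidsBraids

variable {n : ℕ}

theorem of_cons {a : Fin n} {v : List (Fin n)} (h : AvoidsBraids (a :: v)) : AvoidsBraids v :=
  fun x y => ⟨fun b c hbc hv => (h (a :: x) y).1 b c hbc (hv.cons a),
    fun b c hbc hv => (h (a :: x) y).2 b c hbc (hv.cons a)⟩

theorem one_lt_length_filter {a : Fin n} {x y : List (Fin n)}
    (h : AvoidsBraids (a :: (x ++ a :: y))) (hax : a ∉ x) :
    1 < (x.filter (DnMatrix n a · ≠ 2)).length := by
  by_contra! hle
  rcases hf : x.filter (DnMatrix n a · ≠ 2) with _ | ⟨c, z⟩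
  · have hx : ∀ b ∈ x, DnMatrix n a b = 2 := by
      intro b hb
      by_contra hab
      have : b ∈ x.filter (DnMatrix n a · ≠ 2) := List.mem_filter.mpr ⟨hb, by simpa using hab⟩
      rw [hf] at this
      simp at this
    exact (h x y).1 a a rfl (CommEquiv.move_to_front hx _).symm
  · rw [hf] at hle
    obtain rfl : z = [] := by simpa using hle
    obtain ⟨x₁, x₂, rfl, h₁, hc, h₂⟩ := List.filter_eq_cons_iff.mp hf
    have hx₁ : ∀ b ∈ x₁, DnMatrix n a b = 2 := fun b hb => by simpa using h₁ b hb
    have hx₂ : ∀ b ∈ x₂, DnMatrix n a b = 2 := fun b hb => by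
      simpa using List.filter_eq_nil_iff.mp h₂ b hb
    have hac : DnMatrix n a c = 3 := by
      rcases DnMatrix_isSimplyLaced n a c (by rintro rfl; simp at hax) with h2 | h3
      · simp [h2] at hc
      · exact h3
    refine (h x₁ (x₂ ++ y)).2 a c hac ?_
    have e₁ : CommEquiv (DnMatrix n) (a :: (x₁ ++ c :: x₂ ++ a :: y))
        (x₁ ++ a :: c :: (x₂ ++ a :: y)) := by
      simpa using (CommEquiv.move_to_front hx₁ (c :: (x₂ ++ a :: y))).symm
    exact e₁.trans ((((CommEquiv.move_to_front hx₂ y).cons c).cons a).append_left x₁)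

/-- The letters not commuting with `a` between two consecutive occurrences of its level cannot all
lie on one neighbouring level. -/
theorem not_forall_level_eq {a : Fin n} {x y : List (Fin n)}
    (h : AvoidsBraids (a :: (x ++ a :: y))) (hv : IsAlternating (x ++ a :: y))
    (hx : ∀ c ∈ x, DnLevel c ≠ DnLevel a) {k : ℕ}
    (hk : k + 1 = DnLevel a ∨ k = DnLevel a + 1) :
    ¬ ∀ c ∈ x, DnMatrix n a c ≠ 2 → DnLevel c = k := by
  intro hc
  have h1 := h.one_lt_length_filter (fun hax => hx a hax rfl)
  obtain ⟨b, hb⟩ := List.exists_mem_of_length_pos (zero_lt_one.trans h1)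
  obtain ⟨hbx, hab⟩ := List.mem_filter.mp hb
  have hbk := hc b hbx (by simpa using hab)
  have ha := DnLevel_lt a
  have hkn : k < n := hbk ▸ DnLevel_lt b
  have hchain := hv.1 (min k (DnLevel a)) (by omega)
  rw [List.map_append, List.filter_append] at hchain
  replace hchain := (List.isChain_append.mp hchain).1
  have hle : ((x.map DnLevel).filter (inPair (min k (DnLevel a)))).length ≤ 1 := by
    refine length_le_one_of_isChain_ne hchain (k := k) fun l hl => ?_
    obtain ⟨hl, hle⟩ := List.mem_filter.mp hl
    obtain ⟨c, hcx, rfl⟩ := List.mem_map.mp hl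
    have := hx c hcx
    simp only [inPair, decide_eq_true_eq] at hle
    omega
  rw [List.filter_map, List.length_map] at hle
  refine absurd (h1.trans_le ?_) hle.not_gt
  rw [← List.countP_eq_length_filter, ← List.countP_eq_length_filter]
  refine List.countP_mono_left fun c hcx hac => ?_
  have := hc c hcx (by simpa using hac)
  simp only [Function.comp_apply, inPair, decide_eq_true_eq]
  omega

theorem isAlternating (hn : 4 ≤ n) {ω : List (Fin n)} (h : AvoidsBraids ω) :
    IsAlternating ω := by
  induction ω with
  | nil => exact ⟨by simp, by simp⟩
  | cons a v ih =>
    have hv := ih h.of_cons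
    have ha := DnLevel_pos hn a
    have ha' := DnLevel_lt a
    constructor
    · intro e he
      rw [List.map_cons, List.filter_cons]
      split_ifs with hea
      · refine List.isChain_cons.mpr ⟨fun l hl hal => ?_, hv.1 e he⟩
        subst hal
        have hz := List.eq_cons_of_mem_head? hl
        rw [List.filter_map] at hz
        obtain ⟨b, z', hz', hb, -⟩ := List.map_eq_cons_iff.mp hz
        obtain ⟨x, y, rfl, hx, hbe, -⟩ := List.filter_eq_cons_iff.mp hz'
        simp only [inPair, decide_eq_true_eq, Function.comp_apply] at hea hx
        by_cases hab : a = b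
        · subst hab
          have hx' : ∀ c ∈ x, DnLevel c ≠ DnLevel a := fun c hc => by
            have := hx c hc; omega
          obtain ⟨k, hk, hke⟩ : ∃ k, (k + 1 = DnLevel a ∨ k = DnLevel a + 1) ∧
              (DnLevel a = e → k + 1 = e) ∧ (DnLevel a = e + 1 → k = e + 2) := by
            rcases hea with h | h
            · exact ⟨e - 1, by omega, by omega, by omega⟩
            · exact ⟨e + 2, by omega, by omega, by omega⟩
          refine h.not_forall_level_eq hv hx' hk fun c hc hac => ?_
          have := hx c hc
          rw [ne_eq, DnMatrix_eq_two_iff hn] at hac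
          have := hx' c hc
          omega
        · have hlev := DnLevel_eq_of_ne hn hab hb.symm
          refine (h x y).1 a b hb.symm (CommEquiv.move_to_front (fun c hc => ?_) _).symm
          have := hx c hc
          have := DnLevel_lt c
          rw [DnMatrix_eq_two_iff hn]
          omega
      · exact hv.1 e he
    · rw [List.filter_cons]
      split_ifs with hea
      · refine List.isChain_cons.mpr ⟨fun b hb hab => ?_, hv.2⟩
        subst hab
        have hz := List.eq_cons_of_mem_head? hb
        obtain ⟨x, y, rfl, hx, -⟩ := List.filter_eq_cons_iff.mp hz
        simp only [decide_eq_true_eq] at hea hx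
        refine h.not_forall_level_eq hv (k := n - 2) (fun c hc => hea ▸ hx c hc)
          (by omega) fun c hc hac => ?_
        have := hx c hc
        have := DnLevel_lt c
        rw [ne_eq, DnMatrix_eq_two_iff hn] at hac
        omega
      · exact hv.2

end AvoidsBraids

section FullyCommutative

variable {n : ℕ}

theorem avoidsBraids_of_isFullyCommutative (hn : 4 ≤ n) {w : (DnMatrix n).Group}
    (hw : IsFullyCommutative (DnMatrix n).toCoxeterSystem w)
    (hw' : ∀ ω : List (Fin n), (DnMatrix n).toCoxeterSystem.IsReduced ω →
      (DnMatrix n).toCoxeterSystem.wordProd ω = w →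
      ¬ [Fin.castLE hn 0, Fin.castLE hn 1].IsInfix ω)
    {ω : List (Fin n)} (hω : (DnMatrix n).toCoxeterSystem.IsReduced ω)
    (hωw : (DnMatrix n).toCoxeterSystem.wordProd ω = w) : AvoidsBraids ω := by
  set cs := (DnMatrix n).toCoxeterSystem
  have hinfix : ∀ x y : List (Fin n),
      ¬ CommEquiv (DnMatrix n) ω (x ++ Fin.castLE hn 0 :: Fin.castLE hn 1 :: y) := fun x y h =>
    hw' _ (h.isReduced cs hω) ((h.wordProd_eq cs).symm.trans hωw) ⟨x, y, by simp⟩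
  refine fun x y => ⟨fun a b hab h => ?_, fun a b hab h => ?_⟩
  · by_cases hne : a = b
    · subst hne
      have hred := (h.isReduced cs hω).drop x.length
      rw [List.drop_left, CoxeterSystem.IsReduced, CoxeterSystem.wordProd_cons,
        CoxeterSystem.wordProd_cons, CoxeterSystem.simple_mul_simple_cancel_left] at hred
      have := cs.length_wordProd_le y
      simp only [List.length_cons] at hred
      omega
    · have ha := DnLevel_eq hn a
      have hb := DnLevel_eq hn b
      have hlev := DnLevel_eq_of_ne hn hne hab
      have h2 : DnMatrix n a b = 2 := (DnMatrix_eq_two_iff hn).mpr (Or.inr (Or.inr ⟨hne, hab⟩))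
      have hne' : (a : ℕ) ≠ b := fun h => hne (Fin.ext h)
      obtain h0 | h0 : (a : ℕ) = 0 ∧ (b : ℕ) = 1 ∨ (b : ℕ) = 0 ∧ (a : ℕ) = 1 := by omega
      · obtain rfl : a = Fin.castLE hn 0 := Fin.ext h0.1
        obtain rfl : b = Fin.castLE hn 1 := Fin.ext h0.2
        exact hinfix x y h
      · obtain rfl : b = Fin.castLE hn 0 := Fin.ext h0.1
        obtain rfl : a = Fin.castLE hn 1 := Fin.ext h0.2
        exact hinfix x y (h.trans ((CommEquiv.swap h2 y).append_left x))
  · have hp := cs.wordProd_braidWord_eq a b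
    rw [CoxeterSystem.braidWord, CoxeterSystem.braidWord, (DnMatrix n).symmetric b a, hab] at hp
    simp only [CoxeterSystem.alternatingWord, List.concat_eq_append, List.nil_append,
      List.cons_append] at hp
    have hprod : cs.wordProd (x ++ b :: a :: b :: y) = cs.wordProd (x ++ a :: b :: a :: y) := by
      rw [← List.singleton_append (l := y), ← List.singleton_append (l := y)]
      simp only [← List.cons_append, CoxeterSystem.wordProd_append, hp]
    have hred := h.isReduced cs hω
    have hred' : cs.IsReduced (x ++ b :: a :: b :: y) := by
      rw [CoxeterSystem.IsReduced, hprod, hred.eq]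
      simp
    have hw₁ := (h.wordProd_eq cs).symm.trans hωw
    have hperm := (CommEquiv.perm (hw _ _ hred hred' hw₁ (hprod.trans hw₁))).count_eq a
    have hne : b ≠ a := by
      rintro rfl
      simp at hab
    simp [hne] at hperm

theorem exists_labelling (hn : 4 ≤ n) {v : List ℕ} {z : List (Fin n)}
    (hv : ∀ l ∈ v, 1 ≤ l ∧ l ≤ n - 1)
    (hz : ∀ a ∈ z, DnLevel a = n - 1) (h : v.count (n - 1) = z.length) :
    ∃ ω : List (Fin n), ω.map DnLevel = v ∧ ω.filter (DnLevel · = n - 1) = z := by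
  induction v generalizing z with
  | nil =>
    obtain rfl : z = [] := List.length_eq_zero_iff.mp (by simpa using h.symm)
    exact ⟨[], by simp⟩
  | cons l v ih =>
    have hl := hv l (by simp)
    have hv' : ∀ l ∈ v, 1 ≤ l ∧ l ≤ n - 1 := fun l hl => hv l (by simp [hl])
    by_cases hln : l = n - 1
    · subst hln
      rcases z with _ | ⟨a, z⟩
      · simp at h
      · obtain ⟨ω, h₁, h₂⟩ := ih hv' (fun b hb => hz b (List.mem_cons_of_mem a hb))
          (by simpa using h)
        have ha := hz a (by simp)
        exact ⟨a :: ω, by simp [h₁, ha], by simp [h₂, ha]⟩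
    · obtain ⟨ω, h₁, h₂⟩ := ih hv' hz (by simpa [List.count_cons, hln] using h)
      have ha : DnLevel (⟨n - l, by omega⟩ : Fin n) = l := by
        simp only [DnLevel]; omega
      exact ⟨⟨n - l, by omega⟩ :: ω, by simp [h₁, ha], by simp [h₂, ha, hln]⟩

theorem eq_of_map_DnLevel_eq (hn : 4 ≤ n) {ω ω' : List (Fin n)} (h : ω.map DnLevel = ω'.map DnLevel)
    (h' : ω.filter (DnLevel · = n - 1) = ω'.filter (DnLevel · = n - 1)) : ω = ω' := by
  induction ω generalizing ω' with
  | nil => simpa using h.symm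
  | cons a ω ih =>
    rcases ω' with _ | ⟨b, ω'⟩
    · simp at h
    · rw [List.map_cons, List.map_cons, List.cons.injEq] at h
      by_cases ha : DnLevel a = n - 1
      · have hb := h.1.symm.trans ha
        simp only [List.filter_cons, ha, hb, decide_true, if_true, List.cons.injEq] at h'
        rw [h'.1, ih h.2 h'.2]
      · have hb : DnLevel b ≠ n - 1 := h.1 ▸ ha
        simp only [List.filter_cons, ha, hb, decide_false, Bool.false_eq_true, if_false] at h'
        rw [ih h.2 h', not_imp_comm.mp (fun hab => DnLevel_eq_of_ne hn hab h.1) ha]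

end FullyCommutative

/-- The words of length `c` alternating between `s₁̄` and `s₁`. -/
def endWords {n : ℕ} (hn : 4 ≤ n) (c : ℕ) : Finset (List (Fin n)) :=
  {altWord (Fin.castLE hn 0) (Fin.castLE hn 1) c, altWord (Fin.castLE hn 1) (Fin.castLE hn 0) c}

theorem card_endWords {n : ℕ} (hn : 4 ≤ n) (c : ℕ) :
    (endWords hn c).card = (if 0 ≤ c then 1 else 0) + if 1 ≤ c then 1 else 0 := by
  rcases Nat.eq_zero_or_pos c with rfl | hc
  · simp [endWords, altWord]
  · rw [endWords, Finset.card_pair (altWord.ne_swap (by simp) hc.ne')]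
    simp [Nat.one_le_iff_ne_zero, hc.ne']

theorem mem_endWords {n : ℕ} (hn : 4 ≤ n) {c : ℕ} {z : List (Fin n)} :
    z ∈ endWords hn c ↔
      z.IsChain (· ≠ ·) ∧ (∀ a ∈ z, DnLevel a = n - 1) ∧ z.length = c := by
  have hne : Fin.castLE hn 0 ≠ Fin.castLE hn 1 := by simp
  have hlev : ∀ a : Fin n,
      DnLevel a = n - 1 ↔ a = Fin.castLE hn 0 ∨ a = Fin.castLE hn 1 := by
    intro a
    have := DnLevel_eq hn a
    simp only [Fin.ext_iff, Fin.val_castLE, Fin.val_zero, Fin.val_one]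
    omega
  simp only [endWords, Finset.mem_insert, Finset.mem_singleton, hlev]
  constructor
  · rintro (rfl | rfl)
    · exact ⟨altWord.isChain_ne hne c, fun a => altWord.eq_or_eq_of_mem, by simp⟩
    · exact ⟨altWord.isChain_ne hne.symm c, fun a ha => (altWord.eq_or_eq_of_mem ha).symm,
        by simp⟩
  · rintro ⟨hz, hl, rfl⟩
    exact altWord.eq_of_isChain_ne hz hl

/-- A word with sequence of levels `v` and restriction `z` to the letters `s₁̄` and `s₁`. -/
def labelWord {n : ℕ} (v : List ℕ) (z : List (Fin n)) : List (Fin n) :=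
  Classical.epsilon fun ω => ω.map DnLevel = v ∧ ω.filter (DnLevel · = n - 1) = z

theorem labelWord_spec {n : ℕ} (hn : 4 ≤ n) {v : List ℕ} {z : List (Fin n)}
    (hv : v ∈ levelWords (n - 1)) (hz : z ∈ endWords hn (v.count (n - 1))) :
    (labelWord v z).map DnLevel = v ∧ (labelWord v z).filter (DnLevel · = n - 1) = z :=
  have hz := (mem_endWords hn).mp hz
  Classical.epsilon_spec (exists_labelling hn (isLevelWord_of_mem hv).1 hz.2.1 hz.2.2.symm)

/-- Representatives of the commutation classes of alternating words. -/
def alternatingWords {n : ℕ} (hn : 4 ≤ n) : Finset (List (Fin n)) :=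
  ((levelWords (n - 1)).sigma fun v => endWords hn (v.count (n - 1))).image
    fun p => labelWord p.1 p.2

theorem mem_alternatingWords {n : ℕ} (hn : 4 ≤ n) {ω : List (Fin n)} :
    ω ∈ alternatingWords hn ↔
      ω.map DnLevel ∈ levelWords (n - 1) ∧
        ω.filter (DnLevel · = n - 1) ∈ endWords hn ((ω.map DnLevel).count (n - 1)) := by
  simp only [alternatingWords, Finset.mem_image, Finset.mem_sigma]
  constructor
  · rintro ⟨⟨v, z⟩, ⟨hv, hz⟩, rfl⟩
    obtain ⟨h₁, h₂⟩ := labelWord_spec hn hv hz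
    rw [h₁, h₂]
    exact ⟨hv, hz⟩
  · rintro ⟨hv, hz⟩
    obtain ⟨h₁, h₂⟩ := labelWord_spec hn hv hz
    exact ⟨⟨_, _⟩, ⟨hv, hz⟩, eq_of_map_DnLevel_eq hn h₁ h₂⟩

theorem card_alternatingWords {n : ℕ} (hn : 4 ≤ n) :
    (alternatingWords hn).card = n.centralBinom / 2 := by
  have hinj : Set.InjOn (fun p : (_ : List ℕ) × List (Fin n) => labelWord p.1 p.2)
      ((levelWords (n - 1)).sigma fun v => endWords hn (v.count (n - 1))) := by
    rintro ⟨u, z⟩ hp ⟨v, y⟩ hq hpq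
    obtain ⟨hu, hz⟩ := Finset.mem_sigma.mp hp
    obtain ⟨hv, hy⟩ := Finset.mem_sigma.mp hq
    have hp := labelWord_spec hn hu hz
    have hq := labelWord_spec hn hv hy
    dsimp only at hp hq hpq
    rw [hpq] at hp
    obtain rfl : u = v := hp.1.symm.trans hq.1
    obtain rfl : z = y := hp.2.symm.trans hq.2
    rfl
  obtain ⟨m, rfl⟩ : ∃ m, n = m + 1 := ⟨n - 1, by omega⟩
  rw [alternatingWords, Finset.card_image_of_injOn hinj, Finset.card_sigma]
  simp only [card_endWords, Finset.sum_add_distrib, Nat.add_sub_cancel]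
  rw [sum_levelWords_ite, sum_levelWords_ite, Nat.centralBinom_eq_two_mul_choose]
  have h1 := Nat.choose_succ_succ' (2 * m + 1) m
  have h2 := Nat.choose_symm_half m
  have h3 := Nat.choose_succ_succ' (2 * m) m
  rw [show 2 * (m + 1) = 2 * m + 1 + 1 by ring, add_zero]
  omega

theorem isAlternating_of_mem_alternatingWords {n : ℕ} {hn : 4 ≤ n} {ω : List (Fin n)}
    (hω : ω ∈ alternatingWords hn) : IsAlternating ω := by
  obtain ⟨h₁, h₂⟩ := (mem_alternatingWords hn).mp hω
  exact ⟨fun e he => (isLevelWord_of_mem h₁).2 e (by omega), ((mem_endWords hn).mp h₂).1⟩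

theorem eq_of_mem_alternatingWords_of_commEquiv {n : ℕ} {hn : 4 ≤ n} {ω ω' : List (Fin n)}
    (hω : ω ∈ alternatingWords hn) (hω' : ω' ∈ alternatingWords hn)
    (h : CommEquiv (DnMatrix n) ω ω') : ω = ω' := by
  obtain ⟨h₁, h₂⟩ :=
    (isAlternating_of_mem_alternatingWords hω).filter_eq_of_commEquiv hn h
  exact eq_of_map_DnLevel_eq hn (levelWords_ext ((mem_alternatingWords hn).mp hω).1
    ((mem_alternatingWords hn).mp hω').1 fun e _ => (h₁ e).symm) h₂.symm

theorem IsAlternating.exists_mem_alternatingWords {n : ℕ} (hn : 4 ≤ n) {ω : List (Fin n)}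
    (hω : IsAlternating ω) : ∃ ω' ∈ alternatingWords hn, CommEquiv (DnMatrix n) ω' ω := by
  have hlev : ∀ l ∈ ω.map DnLevel, 1 ≤ l ∧ l ≤ n - 1 := by
    intro l hl
    obtain ⟨a, -, rfl⟩ := List.mem_map.mp hl
    have := DnLevel_pos hn a
    have := DnLevel_lt a
    omega
  obtain ⟨v, hv, hvω⟩ := exists_mem_levelWords (d := n - 1) (v := ω.map DnLevel)
    ⟨hlev, fun e he => hω.1 e (by omega)⟩
  have hz : ω.filter (DnLevel · = n - 1) ∈ endWords hn (v.count (n - 1)) := by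
    refine (mem_endWords hn).mpr ⟨hω.2, fun a ha => by simpa using (List.mem_filter.mp ha).2, ?_⟩
    rw [count_eq_of_filter_inPair_eq (fun l hl => ((isLevelWord_of_mem hv).1 l hl).1)
      (fun l hl => (hlev l hl).1) hvω, List.count, List.countP_map, List.countP_eq_length_filter]
    rfl
  obtain ⟨h₁, h₂⟩ := labelWord_spec hn hv hz
  refine ⟨labelWord v (ω.filter (DnLevel · = n - 1)),
    (mem_alternatingWords hn).mpr (by rw [h₁, h₂]; exact ⟨hv, hz⟩), ?_⟩
  refine CommEquiv.of_filter_eq (ι := {e // e < n - 1})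
    (P := fun e a => inPair e.1 (DnLevel a)) (fun a b hab => ?_) fun e => ?_
  · have ha := DnLevel_pos hn a
    have hb := DnLevel_pos hn b
    have ha' := DnLevel_lt a
    have hb' := DnLevel_lt b
    rw [ne_eq, DnMatrix_eq_two_iff hn] at hab
    by_cases h : DnLevel a = DnLevel b
    · exact ⟨⟨DnLevel a - 1, by omega⟩, inPair_iff.mpr (by dsimp only; omega),
        inPair_iff.mpr (by dsimp only; omega)⟩
    · exact ⟨⟨min (DnLevel a) (DnLevel b), by omega⟩, inPair_iff.mpr (by dsimp only; omega),
        inPair_iff.mpr (by dsimp only; omega)⟩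
  · apply eq_of_map_DnLevel_eq hn
    · have := hvω e e.2
      rwa [← h₁, List.filter_map, List.filter_map] at this
    · rw [List.filter_comm, h₂, List.filter_comm _ _ ω]

end Heaps

/-- For `n ≥ 4`, the number of fully commutative elements of `W(Dₙ)` of *type II* — those
such that no reduced word contains `s₁̄ s₁` (indices `0, 1`) as a contiguous subword —
equals `(1/2)·binom(2n, n)`. -/
theorem card_fullyCommutative_typeII_Dn (n : ℕ) (hn : 4 ≤ n) :
    Nat.card {w : (DnMatrix n).Group |
        IsFullyCommutative (DnMatrix n).toCoxeterSystem w ∧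
        ∀ ω : List (Fin n), (DnMatrix n).toCoxeterSystem.IsReduced ω →
          (DnMatrix n).toCoxeterSystem.wordProd ω = w →
          ¬ ([⟨0, by omega⟩, ⟨1, by omega⟩] : List (Fin n)).IsInfix ω} =
      Nat.centralBinom n / 2 := by
  have hset : {w : (DnMatrix n).Group |
        IsFullyCommutative (DnMatrix n).toCoxeterSystem w ∧
        ∀ ω : List (Fin n), (DnMatrix n).toCoxeterSystem.IsReduced ω →
          (DnMatrix n).toCoxeterSystem.wordProd ω = w →
          ¬ ([⟨0, by omega⟩, ⟨1, by omega⟩] : List (Fin n)).IsInfix ω} =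
      (DnMatrix n).toCoxeterSystem.wordProd '' (alternatingWords hn : Set (List (Fin n))) := by
    ext w
    constructor
    · rintro ⟨hw, hw'⟩
      obtain ⟨ω, hω, rfl⟩ := (DnMatrix n).toCoxeterSystem.exists_isReduced w
      have halt := (avoidsBraids_of_isFullyCommutative hn hw hw' hω rfl).isAlternating hn
      obtain ⟨ω', hω', h⟩ := halt.exists_mem_alternatingWords hn
      exact ⟨ω', hω', h.wordProd_eq _⟩
    · rintro ⟨ω, hω, rfl⟩
      have halt := isAlternating_of_mem_alternatingWords hω
      have hcomm := (halt.isReduced_and_commEquiv hn).2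
      refine ⟨fun ω₁ ω₂ h₁ h₂ hω₁ hω₂ =>
        (hcomm ω₁ h₁ hω₁.symm).symm.trans (hcomm ω₂ h₂ hω₂.symm), ?_⟩
      rintro ω' hω' hprod ⟨x, y, rfl⟩
      have := halt.of_commEquiv hn (hcomm _ hω' hprod.symm)
      rw [List.append_assoc] at this
      refine IsAlternating.not_cons_cons_of_level_eq hn ?_ this.of_append
      simp [DnLevel]
  rw [hset, Nat.card_coe_set_eq, Set.InjOn.ncard_image, Set.ncard_coe_finset,
    card_alternatingWords hn]
  intro ω hω ω' hω' h
  have hred := (isAlternating_of_mem_alternatingWords hω').isReduced_and_commEquiv hn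
  exact eq_of_mem_alternatingWords_of_commEquiv hω hω'
    (((isAlternating_of_mem_alternatingWords hω).isReduced_and_commEquiv hn).2 _ hred.1 h)

end
end

section
/- For n ≥ 4, the ℤ[δ]-algebra homomorphism from the Temperley–Lieb algebra TL(A_{n−1}) to the Temperley–Lieb algebra TL(Dₙ) determined by sending the generator bᵢ of TL(A_{n−1}) to the generator bᵢ of TL(Dₙ) for i = 1, …, n−1 is well-defined and injective; hence TL(A_{n−1}) may be regarded as a subalgebra of TL(Dₙ). -/
noncomputable section

/-- Adjacency in the Coxeter graph of type `Aₘ`: the index set is `Fin m`, where `i`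
stands for the generator `s_{i+1}`; the vertices form a path. -/
def AnAdj (m : ℕ) (i j : Fin m) : Prop :=
  (i : ℕ) + 1 = (j : ℕ) ∨ (j : ℕ) + 1 = (i : ℕ)

/-- The defining relations of the Temperley–Lieb algebra associated to a graph `(V, Adj)`
over a commutative ring `R` with parameter `δ`: `bᵢ² = δ·bᵢ`; `bᵢbⱼ = bⱼbᵢ` when `i, j`
are not joined; `bᵢbⱼbᵢ = bᵢ` when `i, j` are joined. -/
inductive TLRel (R : Type*) [CommRing R] (δ : R) {V : Type*} (Adj : V → V → Prop) :
    FreeAlgebra R V → FreeAlgebra R V → Prop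
  | idem (i : V) :
      TLRel R δ Adj (FreeAlgebra.ι R i * FreeAlgebra.ι R i) (δ • FreeAlgebra.ι R i)
  | comm (i j : V) (hne : i ≠ j) (h : ¬ Adj i j) :
      TLRel R δ Adj (FreeAlgebra.ι R i * FreeAlgebra.ι R j)
        (FreeAlgebra.ι R j * FreeAlgebra.ι R i)
  | braid (i j : V) (h : Adj i j) :
      TLRel R δ Adj (FreeAlgebra.ι R i * FreeAlgebra.ι R j * FreeAlgebra.ι R i)
        (FreeAlgebra.ι R i)

/-- The Temperley–Lieb algebra of a graph `(V, Adj)` over `R` with parameter `δ`. -/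
def TLAlg (R : Type*) [CommRing R] (δ : R) {V : Type*} (Adj : V → V → Prop) : Type _ :=
  RingQuot (TLRel R δ Adj)

instance (R : Type*) [CommRing R] (δ : R) {V : Type*} (Adj : V → V → Prop) :
    Ring (TLAlg R δ Adj) := by unfold TLAlg; infer_instance

instance (R : Type*) [CommRing R] (δ : R) {V : Type*} (Adj : V → V → Prop) :
    Algebra R (TLAlg R δ Adj) := by unfold TLAlg; infer_instance

/-- The generator `bᵢ` of the Temperley–Lieb algebra. -/
def TLgen (R : Type*) [CommRing R] (δ : R) {V : Type*} (Adj : V → V → Prop) (i : V) :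
    TLAlg R δ Adj :=
  RingQuot.mkAlgHom R (TLRel R δ Adj) (FreeAlgebra.ι R i)

/-- A map of vertices which preserves adjacency, and sends non-adjacent distinct vertices to
vertices which are equal or non-adjacent, induces a homomorphism of Temperley–Lieb algebras. -/
theorem TLAlg.exists_map (R : Type*) [CommRing R] (δ : R) {V W : Type*} {A : V → V → Prop}
    {B : W → W → Prop} (f : V → W) (hadj : ∀ i j, A i j → B (f i) (f j))
    (hnadj : ∀ i j, i ≠ j → ¬ A i j → f i = f j ∨ ¬ B (f i) (f j)) :
    ∃ φ : TLAlg R δ A →ₐ[R] TLAlg R δ B, ∀ i, φ (TLgen R δ A i) = TLgen R δ B (f i) := by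
  let g : FreeAlgebra R V →ₐ[R] RingQuot (TLRel R δ B) :=
    FreeAlgebra.lift R fun i => RingQuot.mkAlgHom R (TLRel R δ B) (FreeAlgebra.ι R (f i))
  have hg : ∀ ⦃x y⦄, TLRel R δ A x y → g x = g y := by
    rintro _ _ (i | ⟨i, j, hne, h⟩ | ⟨i, j, h⟩)
    · simpa [g] using RingQuot.mkAlgHom_rel R (TLRel.idem (δ := δ) (Adj := B) (f i))
    · by_cases hf : f i = f j
      · simp [g, hf]
      · simpa [g] using RingQuot.mkAlgHom_rel R
          (TLRel.comm (δ := δ) _ _ hf ((hnadj i j hne h).resolve_left hf))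
    · simpa [g] using RingQuot.mkAlgHom_rel R (TLRel.braid (δ := δ) _ _ (hadj i j h))
  refine ⟨RingQuot.liftAlgHom R ⟨g, hg⟩, fun i => ?_⟩
  exact (RingQuot.liftAlgHom_mkAlgHom_apply R g hg _).trans (FreeAlgebra.lift_ι_apply _ _)

/-- Homomorphisms out of a Temperley–Lieb algebra are determined by the generators. -/
theorem TLAlg.algHom_ext {R : Type*} [CommRing R] {δ : R} {V : Type*} {A : V → V → Prop}
    {S : Type*} [Semiring S] [Algebra R S] {φ ψ : TLAlg R δ A →ₐ[R] S}
    (h : ∀ i, φ (TLgen R δ A i) = ψ (TLgen R δ A i)) : φ = ψ :=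
  RingQuot.ringQuot_ext' (S := R) (s := TLRel R δ A) φ ψ (FreeAlgebra.hom_ext (funext h))

/-- For `n ≥ 4`, the `ℤ[δ]`-algebra homomorphism `TL(A_{n−1}) → TL(Dₙ)` sending the
generator `bᵢ` of `TL(A_{n−1})` to the generator `bᵢ` of `TL(Dₙ)` (for `i = 1, …, n−1`) is
well defined and injective; hence `TL(A_{n−1})` is a subalgebra of `TL(Dₙ)`. -/
theorem TLA_injects_TLD (n : ℕ) (hn : 4 ≤ n) :
    ∃ φ : TLAlg (Polynomial ℤ) Polynomial.X (AnAdj (n - 1)) →ₐ[Polynomial ℤ]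
        TLAlg (Polynomial ℤ) Polynomial.X (DnAdj n),
      Function.Injective φ ∧
      ∀ i : Fin (n - 1),
        φ (TLgen (Polynomial ℤ) Polynomial.X (AnAdj (n - 1)) i) =
          TLgen (Polynomial ℤ) Polynomial.X (DnAdj n) ⟨(i : ℕ) + 1, by omega⟩ := by
  obtain ⟨φ, hφ⟩ := TLAlg.exists_map (Polynomial ℤ) Polynomial.X (A := AnAdj (n - 1))
    (B := DnAdj n) (fun i => ⟨(i : ℕ) + 1, by omega⟩)
    (by intro i j; simp only [AnAdj, DnAdj]; omega)
    (by intro i j; simp only [AnAdj, DnAdj]; omega)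
  -- Folding the two end vertices `s₁̄` and `s₁` together gives a retraction.
  obtain ⟨ψ, hψ⟩ := TLAlg.exists_map (Polynomial ℤ) Polynomial.X (A := DnAdj n)
    (B := AnAdj (n - 1)) (fun i => ⟨(i : ℕ) - 1, by omega⟩)
    (by intro i j; simp only [AnAdj, DnAdj]; omega)
    (by intro i j; simp only [AnAdj, DnAdj, ne_eq, Fin.ext_iff]; omega)
  have hψφ : ψ.comp φ = AlgHom.id _ _ := TLAlg.algHom_ext fun i => by simp [hφ, hψ]
  exact ⟨φ, Function.LeftInverse.injective (g := ψ) (DFunLike.congr_fun hψφ), hφ⟩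

end
end
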